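/- Let M ∈ F_2^{m×n}, b ∈ F_2^m, let G = G(M,b), and let u be a magic unitary over a unital C*-algebra indexed by V(G) satisfying the Qut(G) relations. For each i ∈ [n] belonging to some S_k, define y_i = Σ_{β ∈ ±1^{S_k}_{b_k}} α_i β_i · u_{(k,α),(k,β)} for some k with i ∈ S_k and some α ∈ ±1^{S_k}_{b_k}. Then: y_i* = y_i and y_i² = 1; y_i y_j = y_j y_i whenever i,j ∈ S_k for some k ∈ [m]; and for every k ∈ [m], ∏_{i ∈ S_k} y_i = 1 (product taken in increasing order of indices). -/

import Mathlib

open scoped BigOperators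

/-- A magic unitary over a ring with star: every entry is a projection and
every row and column sums to `1`. -/
def IsMagicUnitary {I J A : Type*} [Fintype I] [Fintype J] [Ring A] [StarRing A]
    (u : I → J → A) : Prop :=
  (∀ i j, star (u i j) = u i j) ∧ (∀ i j, u i j * u i j = u i j) ∧
    (∀ i, ∑ j, u i j = 1) ∧ (∀ j, ∑ i, u i j = 1)

/-- The sign `(-1)^x` for `x ∈ F₂`. -/
def signZ (x : ZMod 2) : ℤˣ := if x = 0 then 1 else -1

/-- `S_k = {i : M k i = 1}`. -/
def Sk {m n : ℕ} (M : Matrix (Fin m) (Fin n) (ZMod 2)) (k : Fin m) : Finset (Fin n) :=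
  Finset.univ.filter fun i => M k i = 1

/-- The vertex set of the colored graph `G(M,b)`: pairs `(k, α)` where
`α : ±1^{S_k}` with `∏_{i ∈ S_k} α i = (-1)^{b k}`, encoded as functions on `Fin n`
normalized to `1` off `S_k`. -/
abbrev GVertex {m n : ℕ} (M : Matrix (Fin m) (Fin n) (ZMod 2)) (b : Fin m → ZMod 2) : Type :=
  {p : Fin m × (Fin n → ℤˣ) //
    (∀ i, i ∉ Sk M p.1 → p.2 i = 1) ∧ ∏ i ∈ Sk M p.1, p.2 i = signZ (b p.1)}

/-- `v` and `w` are joined by an edge of color `({l,k}, δ|_{S_l ∩ S_k})` in `G(M,b)`. -/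
def adjC {m n : ℕ} (M : Matrix (Fin m) (Fin n) (ZMod 2)) (b : Fin m → ZMod 2)
    (l k : Fin m) (δ : Fin n → ℤˣ) (v w : GVertex M b) : Prop :=
  ((v.1.1 = l ∧ w.1.1 = k) ∨ (v.1.1 = k ∧ w.1.1 = l)) ∧ v ≠ w ∧
    (Sk M l ∩ Sk M k).Nonempty ∧
    ∀ i ∈ Sk M l ∩ Sk M k, v.1.2 i * w.1.2 i = δ i

open Classical in
/-- The 0/1 adjacency matrix (with entries in `A`) of the color class
`({l,k}, δ|_{S_l ∩ S_k})` of the colored graph `G(M,b)`. -/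
noncomputable def adjMat (A : Type*) [Zero A] [One A] {m n : ℕ}
    (M : Matrix (Fin m) (Fin n) (ZMod 2)) (b : Fin m → ZMod 2)
    (l k : Fin m) (δ : Fin n → ℤˣ) (v w : GVertex M b) : A :=
  if adjC M b l k δ v w then 1 else 0

/-- `u` satisfies the `Qut(G(M,b))` relations: entries vanish between distinct
vertex colors, and `u` commutes with every edge-color adjacency matrix. -/
def QutRel (A : Type*) [Ring A] {m n : ℕ} (M : Matrix (Fin m) (Fin n) (ZMod 2))
    (b : Fin m → ZMod 2) (u : GVertex M b → GVertex M b → A) : Prop :=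
  (∀ v w : GVertex M b, v.1.1 ≠ w.1.1 → u v w = 0) ∧
  ∀ (l k : Fin m) (δ : Fin n → ℤˣ) (v w : GVertex M b),
    ∑ x, adjMat A M b l k δ v x * u x w = ∑ x, u v x * adjMat A M b l k δ x w

/-- The element `y_i = ∑_{β ∈ ±1^{S_k}_{b_k}} α_i β_i · u_{(k,α),(k,β)}`, computed from the
representative vertex `v = (k, α)` (by the block-structure lemma it does not depend on
the choice of representative with `i ∈ S_k`). -/
def yRep {m n : ℕ} {M : Matrix (Fin m) (Fin n) (ZMod 2)} {b : Fin m → ZMod 2}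
    {A : Type*} [Ring A] (u : GVertex M b → GVertex M b → A)
    (v : GVertex M b) (i : Fin n) : A :=
  ∑ w ∈ Finset.univ.filter (fun w : GVertex M b => w.1.1 = v.1.1),
    ((v.1.2 i * w.1.2 i : ℤˣ) : ℤ) • u v w

theorem norm_le_one_of_bounded_pow_two_pow {x C : ℝ}
    (h : ∀ N : ℕ, x ^ (2 ^ N) ≤ C) : x ≤ 1 := by
  by_contra! hx
  obtain ⟨N, hN⟩ := pow_unbounded_of_one_lt C hx
  have := pow_le_pow_right₀ hx.le (Nat.lt_two_pow_self (n := N)).le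
  linarith [h N]

theorem IsIdempotentElem.one_sub_add_mul_pow {A : Type*} [Ring A] {p c : A}
    (hp : IsIdempotentElem p) (hc : Commute c p) (N : ℕ) :
    (1 - p + c * p) ^ N = 1 - p + c ^ N * p := by
  induction N with
  | zero => simp
  | succ N ih =>
    have h1 : c ^ N * p * (c * p) = c ^ (N + 1) * p := by
      rw [mul_assoc, ← mul_assoc p, ← hc.eq, mul_assoc c, hp.eq, ← mul_assoc, pow_succ]
    have h2 : p * (c * p) = c * p := by rw [← mul_assoc, ← hc.eq, mul_assoc, hp.eq]
    have h3 : c ^ N * p * p = c ^ N * p := by rw [mul_assoc, hp.eq]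
    rw [pow_succ, ih]
    simp only [add_mul, sub_mul, mul_add, mul_sub, one_mul, mul_one, h1, h2, h3, hp.eq]
    abel

/-- A star projection in a C⋆-ring over `ℂ` is Hermitian, even when the star is not
assumed to be conjugate-linear. -/
theorem IsStarProjection.norm_one_add_smul_le {A : Type*} [NormedRing A] [StarRing A]
    [CStarRing A] [NormedAlgebra ℂ A] {p : A} (hp : IsStarProjection p) {μ : ℂ} (hμ : ‖μ‖ = 1) :
    ‖1 + (μ - 1) • p‖ ≤ 1 := by
  have hone : ‖(1 : A)‖ ≤ 1 := IsStarProjection.norm_le _ (.one A)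
  set L : A := algebraMap ℂ A μ with hL
  have hLc : ∀ x, Commute L x := Algebra.commutes μ
  have hZc : ∀ x, Commute (star L) x := fun x => by
    simpa using (hLc (star x)).star_star
  have hLn : ‖L‖ ≤ 1 := by
    rw [hL, Algebra.algebraMap_eq_smul_one]
    exact (norm_smul_le _ _).trans (by simpa [hμ] using hone)
  set c : A := star L * L with hcdef
  have hcn : ‖c‖ ≤ 1 := by
    rw [hcdef, CStarRing.norm_star_mul_self]
    exact mul_le_one₀ hLn (norm_nonneg _) hLn
  have hcN : ∀ N, ‖c ^ N‖ ≤ 1 := by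
    intro N
    induction N with
    | zero => simpa using hone
    | succ N ih =>
      rw [pow_succ]
      exact (norm_mul_le _ _).trans (mul_le_one₀ ih (norm_nonneg _) hcn)
  set w : A := 1 + (μ - 1) • p with hw
  have hwL : w = 1 - p + L * p := by
    rw [hw, hL, sub_smul, one_smul, Algebra.smul_def]; abel
  have hh : star w * w = 1 - p + c * p := by
    have h1 : p * star L * (L * p) = c * p := by
      rw [← (hZc p).eq, mul_assoc, ← mul_assoc p, ← (hLc p).eq, mul_assoc L,
        hp.isIdempotentElem.eq, ← mul_assoc]
    have h2 : p * (L * p) = L * p := by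
      rw [← mul_assoc, ← (hLc p).eq, mul_assoc, hp.isIdempotentElem.eq]
    have h3 : p * star L * p = p * star L := by
      rw [mul_assoc, (hZc p).eq, ← mul_assoc, hp.isIdempotentElem.eq]
    rw [hwL]
    simp only [star_add, star_sub, star_one, star_mul, hp.isSelfAdjoint.star_eq, add_mul, sub_mul,
      mul_add, mul_sub, one_mul, mul_one, h1, h2, h3, hp.isIdempotentElem.eq]
    abel
  have hsa : IsSelfAdjoint (star w * w) := IsSelfAdjoint.star_mul_self w
  have hle : ‖star w * w‖ ≤ 1 := by
    refine norm_le_one_of_bounded_pow_two_pow (C := ‖1 - p‖ + 1) fun N => ?_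
    have h1 := congrArg NNReal.toReal (hsa.nnnorm_pow_two_pow N)
    push_cast at h1
    rw [← h1, hh, hp.isIdempotentElem.one_sub_add_mul_pow ((hZc p).mul_left (hLc p))]
    refine (norm_add_le _ _).trans (add_le_add le_rfl ((norm_mul_le _ _).trans ?_))
    exact mul_le_one₀ (hcN _) (norm_nonneg _) hp.norm_le
  rw [CStarRing.norm_star_mul_self] at hle
  nlinarith [norm_nonneg w]

/-- The unit of a corner is a vertex of the unit ball. -/
theorem eq_zero_of_norm_add_smul_le_one {A : Type*} [NormedRing A] [NormedAlgebra ℂ A]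
    [CompleteSpace A] {p a : A} (hp : IsIdempotentElem p) (hpa : p * a = a) (hap : a * p = a)
    {r : ℝ} (hr : 0 < r) (h : ∀ w ∈ Metric.sphere (0 : ℂ) r, ‖p + w • a‖ ≤ 1) : a = 0 := by
  have hder : ∀ N : ℕ, HasDerivAt (fun w : ℂ => (p + w • a) ^ (N + 1)) ((N + 1) • a) 0 := by
    have h1 : HasDerivAt (fun w : ℂ => p + w • a) a 0 := by
      simpa using ((hasDerivAt_id (0 : ℂ)).smul_const a).const_add p
    intro N
    induction N with
    | zero => simpa using h1
    | succ N ih =>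
      have := ih.fun_mul h1
      simp only [zero_smul, add_zero, hp.pow_succ_eq, smul_mul_assoc, hpa, hap] at this
      rw [add_smul _ 1, one_smul]
      simpa only [pow_succ _ (N + 1)] using this
  have hdiff : ∀ N : ℕ, Differentiable ℂ (fun w : ℂ => (p + w • a) ^ N) := fun N => by fun_prop
  have hpow : ∀ w ∈ Metric.sphere (0 : ℂ) r, ∀ N : ℕ, ‖(p + w • a) ^ (N + 1)‖ ≤ 1 := by
    intro w hw N
    exact (norm_pow_le' _ N.succ_pos).trans (pow_le_one₀ (norm_nonneg _) (h w hw))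
  have hbound : ∀ N : ℕ, ((N : ℝ) + 1) * ‖a‖ ≤ 1 / r := by
    intro N
    have := Complex.norm_deriv_le_of_forall_mem_sphere_norm_le hr
      ((hdiff (N + 1)).diffContOnCl) (fun w hw => hpow w hw N)
    rw [(hder N).deriv, ← Nat.cast_smul_eq_nsmul ℂ, norm_smul, Complex.norm_natCast] at this
    exact_mod_cast this
  by_contra hne
  have hpos : 0 < ‖a‖ := norm_pos_iff.2 hne
  obtain ⟨N, hN⟩ := exists_nat_gt (1 / r / ‖a‖)
  rw [div_lt_iff₀ hpos] at hN
  nlinarith [hbound N]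

/-- `x` points, along the two directions `-1 ± i`, into the unit ball at `p`. -/
def PointsInward {A : Type*} [NormedRing A] [NormedAlgebra ℂ A] (p x : A) : Prop :=
  ∃ r : ℝ, 0 < r ∧ ∀ s : ℝ, 0 ≤ s → s ≤ r →
    ‖p + ((s : ℂ) * (Complex.I - 1)) • x‖ ≤ 1 ∧ ‖p + ((s : ℂ) * (-Complex.I - 1)) • x‖ ≤ 1

theorem PointsInward.add {A : Type*} [NormedRing A] [NormedAlgebra ℂ A] {p x y : A}
    (hx : PointsInward p x) (hy : PointsInward p y) : PointsInward p (x + y) := by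
  obtain ⟨r, hr, hx⟩ := hx
  obtain ⟨t, ht, hy⟩ := hy
  have key : ∀ (s : ℝ) (d : ℂ), ‖p + (((2 * s : ℝ) : ℂ) * d) • x‖ ≤ 1 →
      ‖p + (((2 * s : ℝ) : ℂ) * d) • y‖ ≤ 1 → ‖p + ((s : ℂ) * d) • (x + y)‖ ≤ 1 := by
    intro s d h1 h2
    have : p + ((s : ℂ) * d) • (x + y) = (1 / 2 : ℂ) • (p + (((2 * s : ℝ) : ℂ) * d) • x) +
        (1 / 2 : ℂ) • (p + (((2 * s : ℝ) : ℂ) * d) • y) := by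
      push_cast
      module
    rw [this]
    refine (norm_add_le _ _).trans ?_
    rw [norm_smul, norm_smul]
    have h : ‖(1 / 2 : ℂ)‖ = 1 / 2 := by norm_num
    rw [h]
    linarith
  refine ⟨min r t / 2, by positivity, fun s hs0 hs => ?_⟩
  have h1 : 2 * s ≤ r := by linarith [min_le_left r t]
  have h2 : 2 * s ≤ t := by linarith [min_le_right r t]
  obtain ⟨hx1, hx2⟩ := hx (2 * s) (by positivity) h1
  obtain ⟨hy1, hy2⟩ := hy (2 * s) (by positivity) h2
  exact ⟨key s _ hx1 hy1, key s _ hx2 hy2⟩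

theorem convex_norm_add_smul_le {A : Type*} [NormedRing A] [NormedAlgebra ℂ A] (p a : A) :
    Convex ℝ {w : ℂ | ‖p + w • a‖ ≤ 1} := by
  intro x hx y hy s t hs ht hst
  simp only [Set.mem_ofPred_eq] at hx hy ⊢
  have hst' : (s : ℂ) + t = 1 := by exact_mod_cast hst
  have : p + (s • x + t • y) • a = (s : ℂ) • (p + x • a) + (t : ℂ) • (p + y • a) := by
    simp only [Complex.real_smul]
    calc p + ((s : ℂ) * x + t * y) • a = ((s : ℂ) + t) • p + ((s : ℂ) * x + t * y) • a := by
          rw [hst', one_smul]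
      _ = _ := by module
  rw [this]
  refine (norm_add_le _ _).trans ?_
  rw [norm_smul, norm_smul, Complex.norm_real, Complex.norm_real, Real.norm_of_nonneg hs,
    Real.norm_of_nonneg ht]
  nlinarith

theorem PointsInward.eq_zero {A : Type*} [NormedRing A] [NormedAlgebra ℂ A]
    [CompleteSpace A] {p a : A} (hp : IsIdempotentElem p) (hpa : p * a = a) (hap : a * p = a)
    (h : PointsInward p a) (h' : PointsInward p (-a)) : a = 0 := by
  obtain ⟨r, hr, h⟩ := h
  obtain ⟨t, ht, h'⟩ := h'
  have hm : 0 < min r t := lt_min hr ht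
  obtain ⟨h1, h2⟩ := h _ hm.le (min_le_left r t)
  obtain ⟨h3, h4⟩ := h' _ hm.le (min_le_right r t)
  set s := min r t
  have hsq : ({-s, s} : Set ℝ) ×ℂ {-s, s} ⊆ {w : ℂ | ‖p + w • a‖ ≤ 1} := by
    rintro ⟨x, y⟩ ⟨hx, hy⟩
    rw [smul_neg, ← neg_smul] at h3 h4
    simp only [Set.mem_preimage, Set.mem_insert_iff, Set.mem_singleton_iff] at hx hy
    rw [Set.mem_ofPred_eq]
    rcases hx with rfl | rfl <;> rcases hy with rfl | rfl
    · convert h2 using 4; apply Complex.ext <;> simp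
    · convert h1 using 4; apply Complex.ext <;> simp
    · convert h3 using 4; apply Complex.ext <;> simp
    · convert h4 using 4; apply Complex.ext <;> simp
  have hhull := convexHull_min hsq (convex_norm_add_smul_le p a)
  rw [Complex.convexHull_reProdIm, convexHull_pair, segment_eq_Icc (by linarith)] at hhull
  refine eq_zero_of_norm_add_smul_le_one hp hpa hap hm fun w hw => hhull ?_
  have hw' : ‖w‖ = s := by simpa using hw
  exact ⟨abs_le.1 (hw' ▸ Complex.abs_re_le_norm w), abs_le.1 (hw' ▸ Complex.abs_im_le_norm w)⟩

theorem IsStarProjection.pointsInward_compress {A : Type*} [NormedRing A] [StarRing A]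
    [CStarRing A] [NormedAlgebra ℂ A] {p q : A} (hp : IsStarProjection p)
    (hq : IsStarProjection q) : PointsInward p (p * q * p) := by
  have key : ∀ μ : ℂ, ‖μ‖ = 1 → ‖p + (μ - 1) • (p * q * p)‖ ≤ 1 := by
    intro μ hμ
    have : p + (μ - 1) • (p * q * p) = p * (1 + (μ - 1) • q) * p := by
      rw [mul_add, mul_one, add_mul, hp.isIdempotentElem.eq, mul_smul_comm, smul_mul_assoc]
    rw [this]
    refine (norm_mul_le _ _).trans (mul_le_one₀ ((norm_mul_le _ _).trans ?_) (norm_nonneg _)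
      hp.norm_le)
    exact mul_le_one₀ hp.norm_le (norm_nonneg _) (hq.norm_one_add_smul_le hμ)
  have hconv := convex_norm_add_smul_le p (p * q * p)
  have h0 : (0 : ℂ) ∈ {w : ℂ | ‖p + w • (p * q * p)‖ ≤ 1} := by
    simpa using hp.norm_le
  refine ⟨1, one_pos, fun s hs0 hs1 => ?_⟩
  have hmem : ∀ μ : ℂ, ‖μ‖ = 1 → ‖p + ((s : ℂ) * (μ - 1)) • (p * q * p)‖ ≤ 1 := fun μ hμ => by
    simpa using hconv.smul_mem_of_zero_mem h0 (key μ hμ) ⟨hs0, hs1⟩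
  exact ⟨hmem _ (by simp), hmem _ (by simp)⟩

/-- Star projections summing to `1` are pairwise orthogonal. -/
theorem IsStarProjection.mul_eq_zero_of_sum_eq_one {ι A : Type*} [Fintype ι] [NormedRing A]
    [StarRing A] [CStarRing A] [NormedAlgebra ℂ A] [CompleteSpace A] {p : ι → A}
    (hp : ∀ i, IsStarProjection (p i)) (hsum : ∑ i, p i = 1) {i j : ι} (hij : i ≠ j) :
    p i * p j = 0 := by
  classical
  have hid : ∀ i, p i * p i = p i := fun i => (hp i).isIdempotentElem.eq
  have hzero : p j * p i * p j = 0 := by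
    have h1 : ∑ k, p j * p k * p j = p j := by
      rw [← Finset.sum_mul, ← Finset.mul_sum, hsum, mul_one, hid]
    have h2 : -(p j * p i * p j) = ∑ k ∈ (Finset.univ.erase j).erase i, p j * p k * p j := by
      rw [← Finset.add_sum_erase _ _ (Finset.mem_univ j), hid, hid, add_eq_left,
        ← Finset.add_sum_erase _ _ (Finset.mem_erase.2 ⟨hij, Finset.mem_univ i⟩)] at h1
      exact neg_eq_of_add_eq_zero_right h1
    refine PointsInward.eq_zero (hp j).isIdempotentElem ?_ ?_
      ((hp j).pointsInward_compress (hp i)) ?_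
    · rw [← mul_assoc, ← mul_assoc, hid]
    · rw [mul_assoc, hid]
    · rw [h2]
      refine Finset.sum_induction _ (PointsInward (p j)) (fun _ _ => PointsInward.add) ?_
        fun k _ => (hp j).pointsInward_compress (hp k)
      exact ⟨1, one_pos, fun s _ _ => by simpa using (hp j).norm_le⟩
  rw [← CStarRing.star_mul_self_eq_zero_iff, star_mul, (hp i).isSelfAdjoint.star_eq,
    (hp j).isSelfAdjoint.star_eq, mul_assoc, ← mul_assoc (p i), hid, ← mul_assoc, hzero]

/-- The algebra homomorphism on functions determined by a partition of unity, as a map of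
multiplicative monoids. -/
def sumZSMulHom {I A : Type*} [Fintype I] [Ring A] (q : I → A) (hid : ∀ x, q x * q x = q x)
    (horth : ∀ x y, x ≠ y → q x * q y = 0) (hsum : ∑ x, q x = 1) : (I → ℤˣ) →* A where
  toFun c := ∑ x, ((c x : ℤˣ) : ℤ) • q x
  map_one' := by simpa using hsum
  map_mul' c d := by
    rw [Finset.sum_mul]
    refine Finset.sum_congr rfl fun x _ => ?_
    rw [Finset.mul_sum, Finset.sum_eq_single x]
    · rw [smul_mul_smul_comm, hid, Pi.mul_apply, Units.val_mul]
    · intro y _ hy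
      rw [smul_mul_smul_comm, horth x y hy.symm, smul_zero]
    · simp

section ColoredGraph

variable {m n : ℕ} {M : Matrix (Fin m) (Fin n) (ZMod 2)} {b : Fin m → ZMod 2}

theorem mem_Sk {k : Fin m} {i : Fin n} : i ∈ Sk M k ↔ M k i = 1 := by simp [Sk]

theorem exists_vertex_of_mem_Sk {k : Fin m} {i : Fin n} (hi : i ∈ Sk M k) :
    ∃ z : GVertex M b, z.1.1 = k := by
  refine ⟨⟨(k, Function.update 1 i (signZ (b k))), fun j hj => ?_, ?_⟩, rfl⟩
  · have hne : j ≠ i := fun h => hj (h ▸ hi)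
    simp [hne]
  · rw [Finset.prod_eq_single i (fun j _ hj => by simp [hj]) fun h => absurd hi h]
    simp

theorem vertex_ext_of_eqOn {v w : GVertex M b} (h1 : v.1.1 = w.1.1)
    (h2 : ∀ i ∈ Sk M v.1.1, v.1.2 i = w.1.2 i) : v = w := by
  refine Subtype.ext (Prod.ext h1 (funext fun i => ?_))
  by_cases hi : i ∈ Sk M v.1.1
  · exact h2 i hi
  · rw [v.2.1 i hi, w.2.1 i (h1 ▸ hi)]

theorem yRep_eq_sum {A : Type*} [Ring A] {u : GVertex M b → GVertex M b → A}
    (hqut : QutRel A M b u) (v : GVertex M b) (i : Fin n) :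
    yRep u v i = ∑ w, ((v.1.2 i * w.1.2 i : ℤˣ) : ℤ) • u v w := by
  refine Finset.sum_subset (Finset.filter_subset _ _) fun w _ hw => ?_
  rw [hqut.1 v w fun h => hw (by simp [h]), smul_zero]

/-- The difference `x △ w` restricted to `S_l ∩ S_k`, extended by `1`. -/
def diffOn (M : Matrix (Fin m) (Fin n) (ZMod 2)) (l k : Fin m) (x w : Fin n → ℤˣ) : Fin n → ℤˣ :=
  fun j => if j ∈ Sk M l ∩ Sk M k then x j * w j else 1

theorem diffOn_eq_iff {l k : Fin m} {x w δ : Fin n → ℤˣ}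
    (hδ : ∀ j, j ∉ Sk M l ∩ Sk M k → δ j = 1) :
    diffOn M l k x w = δ ↔ ∀ j ∈ Sk M l ∩ Sk M k, x j * w j = δ j := by
  constructor
  · rintro rfl j hj
    rw [diffOn, if_pos hj]
  · intro h
    funext j
    by_cases hj : j ∈ Sk M l ∩ Sk M k
    · rw [diffOn, if_pos hj, h j hj]
    · rw [diffOn, if_neg hj, hδ j hj]

open Classical in
/-- The `Qut` relation for a single color, with loops allowed. -/
theorem QutRel.sum_filter_eq {A : Type*} [Ring A] {u : GVertex M b → GVertex M b → A}
    (hqut : QutRel A M b u) {v w : GVertex M b}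
    (hne : (Sk M v.1.1 ∩ Sk M w.1.1).Nonempty) (δ : Fin n → ℤˣ) :
    ∑ x with x.1.1 = w.1.1 ∧ ∀ j ∈ Sk M v.1.1 ∩ Sk M w.1.1, v.1.2 j * x.1.2 j = δ j, u x w =
      ∑ x with x.1.1 = v.1.1 ∧ ∀ j ∈ Sk M v.1.1 ∩ Sk M w.1.1, x.1.2 j * w.1.2 j = δ j, u v x := by
  by_cases hloop : v.1.1 = w.1.1 ∧ ∀ j ∈ Sk M v.1.1 ∩ Sk M w.1.1, δ j = 1
  · obtain ⟨hvw, hδ⟩ := hloop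
    have hl : ∀ x : GVertex M b, (x.1.1 = w.1.1 ∧
        ∀ j ∈ Sk M v.1.1 ∩ Sk M w.1.1, v.1.2 j * x.1.2 j = δ j) ↔ x = v := by
      intro x
      constructor
      · rintro ⟨h1, h2⟩
        refine vertex_ext_of_eqOn (h1.trans hvw.symm) fun j hj => ?_
        have hj' : j ∈ Sk M v.1.1 ∩ Sk M w.1.1 := by
          rw [h1] at hj
          exact Finset.mem_inter.2 ⟨hvw ▸ hj, hj⟩
        have := (h2 j hj').trans (hδ j hj')
        exact (inv_eq_of_mul_eq_one_right this).symm.trans (Int.units_inv_eq_self _)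
      · rintro rfl
        exact ⟨hvw, fun j hj => by rw [Int.units_mul_self, hδ j hj]⟩
    have hr : ∀ x : GVertex M b, (x.1.1 = v.1.1 ∧
        ∀ j ∈ Sk M v.1.1 ∩ Sk M w.1.1, x.1.2 j * w.1.2 j = δ j) ↔ x = w := by
      intro x
      constructor
      · rintro ⟨h1, h2⟩
        refine vertex_ext_of_eqOn (h1.trans hvw) fun j hj => ?_
        have hj' : j ∈ Sk M v.1.1 ∩ Sk M w.1.1 := by
          rw [h1] at hj
          exact Finset.mem_inter.2 ⟨hj, hvw ▸ hj⟩
        have := (h2 j hj').trans (hδ j hj')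
        exact (eq_inv_of_mul_eq_one_left this).trans (Int.units_inv_eq_self _)
      · rintro rfl
        exact ⟨hvw.symm, fun j hj => by rw [Int.units_mul_self, hδ j hj]⟩
    simp only [hl, hr, Finset.filter_eq', Finset.mem_univ, if_true, Finset.sum_singleton]
  · have h := hqut.2 v.1.1 w.1.1 δ v w
    simp only [adjMat, ite_mul, mul_ite, one_mul, mul_one, zero_mul, mul_zero,
      ← Finset.sum_filter] at h
    have hl : ∀ x : GVertex M b, adjC M b v.1.1 w.1.1 δ v x ↔ (x.1.1 = w.1.1 ∧
        ∀ j ∈ Sk M v.1.1 ∩ Sk M w.1.1, v.1.2 j * x.1.2 j = δ j) := by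
      intro x
      constructor
      · rintro ⟨hc, -, -, h2⟩
        refine ⟨?_, h2⟩
        rcases hc with hc | hc
        · exact hc.2
        · exact hc.2.trans hc.1
      · rintro ⟨h1, h2⟩
        refine ⟨.inl ⟨rfl, h1⟩, ?_, hne, h2⟩
        rintro rfl
        exact hloop ⟨h1, fun j hj => by rw [← h2 j hj, Int.units_mul_self]⟩
    have hr : ∀ x : GVertex M b, adjC M b v.1.1 w.1.1 δ x w ↔ (x.1.1 = v.1.1 ∧
        ∀ j ∈ Sk M v.1.1 ∩ Sk M w.1.1, x.1.2 j * w.1.2 j = δ j) := by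
      intro x
      constructor
      · rintro ⟨hc, -, -, h2⟩
        refine ⟨?_, h2⟩
        rcases hc with hc | hc
        · exact hc.1
        · exact hc.1.trans hc.2
      · rintro ⟨h1, h2⟩
        refine ⟨.inl ⟨h1, rfl⟩, ?_, hne, h2⟩
        rintro rfl
        exact hloop ⟨h1.symm, fun j hj => by rw [← h2 j hj, Int.units_mul_self]⟩
    simpa only [hl, hr] using h

open Classical in
/-- The row sum weighted by the sign at `i` agrees with the corresponding column sum. -/
theorem QutRel.row_eq_column {A : Type*} [Ring A] {u : GVertex M b → GVertex M b → A}
    (hqut : QutRel A M b u) {v w : GVertex M b} {i : Fin n}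
    (hi : i ∈ Sk M v.1.1 ∩ Sk M w.1.1) :
    ∑ x with x.1.1 = w.1.1, ((v.1.2 i * x.1.2 i : ℤˣ) : ℤ) • u x w =
      ∑ x with x.1.1 = v.1.1, ((x.1.2 i * w.1.2 i : ℤˣ) : ℤ) • u v x := by
  rw [← Finset.sum_fiberwise (g := fun x : GVertex M b => diffOn M v.1.1 w.1.1 v.1.2 x.1.2),
    ← Finset.sum_fiberwise (g := fun x : GVertex M b => diffOn M v.1.1 w.1.1 x.1.2 w.1.2)]
  refine Finset.sum_congr rfl fun δ _ => ?_
  have hout : ∀ x y : Fin n → ℤˣ, diffOn M v.1.1 w.1.1 x y = δ →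
      ∀ j, j ∉ Sk M v.1.1 ∩ Sk M w.1.1 → δ j = 1 := by
    rintro x y rfl j hj
    rw [diffOn, if_neg hj]
  by_cases hδ : ∀ j, j ∉ Sk M v.1.1 ∩ Sk M w.1.1 → δ j = 1
  · have h := congrArg (fun a => ((δ i : ℤˣ) : ℤ) • a) (hqut.sum_filter_eq ⟨i, hi⟩ δ)
    simp only [Finset.smul_sum] at h
    simp only [Finset.filter_filter, diffOn_eq_iff hδ]
    refine Eq.trans ?_ (h.trans ?_)
    · refine Finset.sum_congr rfl fun x hx => ?_
      rw [(Finset.mem_filter.1 hx).2.2 i hi]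
    · refine Finset.sum_congr rfl fun x hx => ?_
      rw [(Finset.mem_filter.1 hx).2.2 i hi]
  · rw [Finset.filter_false_of_mem fun x _ hx => hδ (hout _ _ hx),
      Finset.filter_false_of_mem fun x _ hx => hδ (hout _ _ hx)]
    simp

theorem QutRel.yRep_eq_column {A : Type*} [Ring A] {u : GVertex M b → GVertex M b → A}
    (hqut : QutRel A M b u) {v w : GVertex M b} {i : Fin n}
    (hi : i ∈ Sk M v.1.1 ∩ Sk M w.1.1) :
    yRep u v i = ∑ x with x.1.1 = w.1.1, ((x.1.2 i * w.1.2 i : ℤˣ) : ℤ) • u x w := by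
  classical
  have h := congrArg (fun a => ((v.1.2 i * w.1.2 i : ℤˣ) : ℤ) • a) (hqut.row_eq_column hi)
  simp only [Finset.smul_sum, smul_smul, ← Units.val_mul] at h
  have hv := Int.units_mul_self (v.1.2 i)
  have hw := Int.units_mul_self (w.1.2 i)
  refine Eq.trans ?_ (h.symm.trans ?_)
  · refine Finset.sum_congr (by congr) fun x _ => ?_
    rw [mul_comm (x.1.2 i), mul_assoc (v.1.2 i), ← mul_assoc (w.1.2 i), hw, one_mul]
  · refine Finset.sum_congr rfl fun x _ => ?_
    rw [mul_comm (v.1.2 i) (w.1.2 i), mul_assoc, ← mul_assoc (v.1.2 i), hv, one_mul, mul_comm]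

/-- `yRep u v i` does not depend on the representative `v`. -/
theorem QutRel.yRep_eq_yRep {A : Type*} [Ring A] {u : GVertex M b → GVertex M b → A}
    (hqut : QutRel A M b u) {v w : GVertex M b} {i : Fin n}
    (hv : i ∈ Sk M v.1.1) (hw : i ∈ Sk M w.1.1) : yRep u v i = yRep u w i :=
  (hqut.yRep_eq_column (Finset.mem_inter.2 ⟨hv, hw⟩)).trans
    (hqut.yRep_eq_column (Finset.mem_inter.2 ⟨hw, hw⟩)).symm

/-- For a fixed vertex `v`, the elements `yRep u v i` are the images of sign functions under a
multiplicative map. -/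
theorem exists_hom_yRep {A : Type*} [NormedRing A] [StarRing A] [CStarRing A] [NormedAlgebra ℂ A]
    [CompleteSpace A] {u : GVertex M b → GVertex M b → A}
    (hmu : IsMagicUnitary u) (hqut : QutRel A M b u) (v : GVertex M b) :
    ∃ φ : (GVertex M b → ℤˣ) →* A, (∀ c, φ c = ∑ w, ((c w : ℤˣ) : ℤ) • u v w) ∧
      ∀ i, yRep u v i = φ fun w => v.1.2 i * w.1.2 i := by
  obtain ⟨hstar, hid, hrow, -⟩ := hmu
  have horth : ∀ x y, x ≠ y → u v x * u v y = 0 := fun x y hxy =>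
    IsStarProjection.mul_eq_zero_of_sum_eq_one (fun z => ⟨hid v z, hstar v z⟩) (hrow v) hxy
  exact ⟨sumZSMulHom (u v) (hid v) horth (hrow v), fun _ => rfl, yRep_eq_sum hqut v⟩

end ColoredGraph

/-- The elements `y_i` built from a magic unitary satisfying the `Qut(G(M,b))` relations
are self-adjoint involutions, commute whenever `i, j ∈ S_k` for some `k`, and satisfy
`∏_{i ∈ S_k} y_i = 1` (product in increasing order of indices) for every `k`. -/
theorem ySolutionGroupRelations {m n : ℕ} (M : Matrix (Fin m) (Fin n) (ZMod 2))
    (b : Fin m → ZMod 2)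
    {A : Type*} [NormedRing A] [StarRing A] [CStarRing A] [NormedAlgebra ℂ A]
    [CompleteSpace A]
    (u : GVertex M b → GVertex M b → A)
    (hmu : IsMagicUnitary u) (hqut : QutRel A M b u) :
    (∀ (i : Fin n) (v : GVertex M b), M v.1.1 i = 1 →
      star (yRep u v i) = yRep u v i ∧ yRep u v i * yRep u v i = 1) ∧
    (∀ (k : Fin m) (i j : Fin n), i ∈ Sk M k → j ∈ Sk M k →
      ∀ v w : GVertex M b, M v.1.1 i = 1 → M w.1.1 j = 1 →
        yRep u v i * yRep u w j = yRep u w j * yRep u v i) ∧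
    (∀ (k : Fin m) (v : GVertex M b), v.1.1 = k →
      (((Sk M k).sort (· ≤ ·)).map (fun i => yRep u v i)).prod = 1) := by
  refine ⟨fun i v _ => ?_, fun k i j hi hj v w hv hw => ?_, ?_⟩
  · obtain ⟨φ, -, hφ⟩ := exists_hom_yRep hmu hqut v
    constructor
    · simp only [yRep, star_sum, star_zsmul, hmu.1]
    · rw [hφ, ← map_mul, ← map_one φ]
      congr 1
      funext x
      exact Int.units_mul_self _
  · obtain ⟨z, rfl⟩ := exists_vertex_of_mem_Sk (b := b) hi
    rw [hqut.yRep_eq_yRep (mem_Sk.2 hv) hi, hqut.yRep_eq_yRep (mem_Sk.2 hw) hj]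
    obtain ⟨φ, -, hφ⟩ := exists_hom_yRep hmu hqut z
    rw [hφ, hφ, ← map_mul, ← map_mul, mul_comm]
  · rintro k v rfl
    obtain ⟨φ, hφsum, hφ⟩ := exists_hom_yRep hmu hqut v
    have hprod : (((Sk M v.1.1).sort (· ≤ ·)).map (fun i => yRep u v i)).prod =
        φ (∏ i ∈ Sk M v.1.1, fun w => v.1.2 i * w.1.2 i) := by
      rw [← Finset.prod_map_toList, ← (((Finset.sort_perm_toList (Sk M v.1.1) (· ≤ ·)).map _).prod_eq),
        map_list_prod, List.map_map]
      simp only [hφ, Function.comp_def]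
    rw [hprod, hφsum, ← hmu.2.2.1 v]
    refine Finset.sum_congr rfl fun w _ => ?_
    by_cases hvw : v.1.1 = w.1.1
    · have hw := w.2.2
      rw [← hvw] at hw
      rw [Finset.prod_apply, Finset.prod_mul_distrib, v.2.2, hw, Int.units_mul_self, Units.val_one,
        one_smul]
    · rw [hqut.1 v w hvw, smul_zero]
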